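/- Separated factors of the Fibonacci word: let ω ∉ {ε, ab, ba, aba} be a factor of F_∞ and let k be the unique index with f_k ≤ |ω| < f_{k+1}. Then the following are equivalent: (i) there exists p ≥ 1 such that the three gaps ν_{ω,p}, ν_{ω,p+1}, ν_{ω,p+2} are all nonempty words (three consecutive pairs of occurrences separated); (ii) for every p ≥ 1 the gap ν_{ω,p} is a nonempty word, i.e., every pair of consecutive occurrences of ω in F_∞ is separated by a nonempty word; (iii) sk(ω) = s_k, i.e., ω ∈ T1.1 ⊔ T2.1. -/

import Mathlib

/-- Finite Fibonacci words: `Fw k = σ^k(a)` where `a = false`, `b = true`,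
`σ(a) = ab`, `σ(b) = a`; so `Fw (k+2) = Fw (k+1) ++ Fw k`. -/
def Fw : ℕ → List Bool
  | 0 => [false]
  | 1 => [false, true]
  | (k+2) => Fw (k+1) ++ Fw k

/-- The infinite Fibonacci word `F_∞` (0-indexed): since `Fw (n+1)` has length
`fib (n+3) > n`, its `n`-th letter is the `n`-th letter of `F_∞`. -/
def fw (n : ℕ) : Bool := (Fw (n+1)).getD n false

/-- Singular words, with index shifted by one: `sw n = s_{n-1}`.
`sw 0 = s_{-1} = a`, and `sw (n+1) = s_n = β_n · F_n · α_n⁻¹` where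
`α_n` is the last letter of `F_n` and `β_n` the other letter. -/
def sw : ℕ → List Bool
  | 0 => [false]
  | (n+1) => (!((Fw n).getLastD false)) :: (Fw n).dropLast

/-- The factor of `F_∞` of length `n` starting at (0-indexed) position `i`. -/
def seg (i n : ℕ) : List Bool := (List.range n).map (fun t => fw (i + t))

/-- `w` occurs in `F_∞` at (0-indexed) position `i`. -/
def OccursAt (w : List Bool) (i : ℕ) : Prop := seg i w.length = w

/-- `w` is a factor of `F_∞`. -/
def IsFactor (w : List Bool) : Prop := ∃ i, OccursAt w i

/-- Starting position of the `(p+1)`-st occurrence of `w` in `F_∞`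
(occurrences enumerated by starting position, 0-indexed: `occPos w 0`
is the first occurrence, i.e. the paper's `ω_1`). -/
noncomputable def occPos (w : List Bool) (p : ℕ) : ℕ := Nat.nth (OccursAt w) p

/-- A finite word viewed as an element of the free group on the alphabet. -/
def listToFree (w : List Bool) : FreeGroup Bool := (w.map FreeGroup.of).prod

/-- The gap `ν_{w,p}` (0-indexed in `p`: `gap w 0` is the paper's `ν_{w,1}`)
between the `(p+1)`-st and `(p+2)`-nd occurrences of `w`, as an element of the
free group: the separating word if the occurrences are separated or adjacent,
and the formal inverse of the overlap if they overlap. -/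
noncomputable def gap (w : List Bool) (p : ℕ) : FreeGroup Bool :=
  if occPos w p + w.length ≤ occPos w (p+1) then
    listToFree (seg (occPos w p + w.length) (occPos w (p+1) - (occPos w p + w.length)))
  else
    (listToFree (seg (occPos w (p+1)) (occPos w p + w.length - occPos w (p+1))))⁻¹

/-- The signed length `|ν_{w,p}|` of the gap (negative in the overlapped case). -/
noncomputable def gapLen (w : List Bool) (p : ℕ) : ℤ :=
  (occPos w (p+1) : ℤ) - ((occPos w p : ℤ) + (w.length : ℤ))

/-- `u` is a singular word (some `s_k`, `k ≥ -1`). -/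
def IsSingular (u : List Bool) : Prop := ∃ n, u = sw n

/-- `u` is a singular kernel of `w`: a singular factor of `w` of maximal length. -/
def IsKernelOf (u w : List Bool) : Prop :=
  IsSingular u ∧ u <:+: w ∧ ∀ v : List Bool, IsSingular v → v <:+: w → v.length ≤ u.length

/-- The excluded words `{ε, ab, ba, aba}`. -/
def excl : List (List Bool) := [[], [false, true], [true, false], [false, true, false]]

/-- The `i`-th conjugate `C_i(w)` (indices taken mod the length). -/
def conj (i : ℕ) (w : List Bool) : List Bool :=
  w.drop (i % w.length) ++ w.take (i % w.length)

/-- `sliceW u i j = u[i,j]`, the letters `i` through `j` of `u`, 1-indexed. -/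
def sliceW (u : List Bool) (i j : ℕ) : List Bool := (u.take j).drop (i - 1)

/-- The image `σ^k(c)` of a letter: `σ^k(a) = F_k` and `σ^k(b) = F_{k-1}`, with `F_{-1} = b`. -/
def letterImage : ℕ → Bool → List Bool
  | k, false => Fw k
  | 0, true => [true]
  | k + 1, true => Fw k

/-- The starting position in `F_∞` of the image under `σ^k` of its `j`-th letter. -/
def imagePos (k : ℕ) : ℕ → ℕ
  | 0 => 0
  | j + 1 => imagePos k j + (letterImage k (fw j)).length

/-- `F_∞` is cut after each image `σ^k(b)`; `IsBlock k e d` says that one of the resulting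
pieces starts at `e` and has length `d`. It is then `σ^k(ab)` or `σ^k(aab)`. -/
def IsBlock (k e d : ℕ) : Prop :=
  ∃ j, (j = 0 ∨ ∃ i, j = i + 1 ∧ fw i = true) ∧ e = imagePos k j ∧
    ((fw j = false ∧ fw (j + 1) = true ∧ fw (j + 2) = false ∧
        d = Nat.fib (k + 2) + Nat.fib (k + 1)) ∨
      (fw j = false ∧ fw (j + 1) = false ∧ fw (j + 2) = true ∧ fw (j + 3) = false ∧
        d = 2 * Nat.fib (k + 2) + Nat.fib (k + 1)))

/-! ### Segments of `F_∞` -/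

@[simp] lemma length_Fw (k : ℕ) : (Fw k).length = Nat.fib (k + 2) := by
  induction k using Fw.induct with
  | case1 => rfl
  | case2 => rfl
  | case3 k h1 h2 =>
    rw [Fw, List.length_append, h1, h2, Nat.fib_add_two (n := k + 2)]
    exact Nat.add_comm _ _

lemma Fw_prefix_succ (k : ℕ) : Fw k <+: Fw (k + 1) := by
  cases k with
  | zero => exact ⟨[true], rfl⟩
  | succ k => exact ⟨Fw k, by rw [Fw]⟩

lemma Fw_prefix_of_le {k l : ℕ} (h : k ≤ l) : Fw k <+: Fw l := by
  induction l, h using Nat.le_induction with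
  | base => exact List.prefix_rfl
  | succ l _ ih => exact ih.trans (Fw_prefix_succ l)

lemma Fw_getElem? {m i : ℕ} (h : i < (Fw m).length) : (Fw m)[i]? = some (fw i) := by
  have hi : i < (Fw (i + 1)).length := by
    have := Nat.le_fib_add_one (i + 3)
    rw [length_Fw]
    change i < Nat.fib (i + 3)
    omega
  have h3 : (Fw (i + 1))[i]? = some (fw i) := by
    rw [fw, List.getD_eq_getElem _ _ hi, List.getElem?_eq_getElem hi]
  rcases le_total m (i + 1) with hm | hm
  · rw [← h3, List.prefix_iff_getElem?.1 (Fw_prefix_of_le hm) i h, List.getElem?_eq_getElem h]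
  · rw [List.prefix_iff_getElem?.1 (Fw_prefix_of_le hm) i hi, ← h3, List.getElem?_eq_getElem hi]

@[simp] lemma length_seg (i n : ℕ) : (seg i n).length = n := by simp [seg]

lemma seg_add (i m n : ℕ) : seg i (m + n) = seg i m ++ seg (i + m) n := by
  simp [seg, List.range_add, Nat.add_assoc, Function.comp_def]

lemma seg_one (i : ℕ) : seg i 1 = [fw i] := rfl

lemma seg_succ (i n : ℕ) : seg i (n + 1) = fw i :: seg (i + 1) n := by
  rw [Nat.add_comm, seg_add, seg_one]; rfl

lemma seg_eq_seg_iff {i j n : ℕ} : seg i n = seg j n ↔ ∀ t < n, fw (i + t) = fw (j + t) := by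
  simp [seg]

lemma seg_zero_length_Fw (m : ℕ) : seg 0 (Fw m).length = Fw m := by
  apply List.ext_getElem?
  intro i
  by_cases h : i < (Fw m).length
  · rw [Fw_getElem? h]
    simp [seg, -length_Fw, h]
  · rw [List.getElem?_eq_none (by simpa using h), List.getElem?_eq_none (by simpa using h)]

lemma eq_seg_of_prefix_seg {l : List Bool} {i n : ℕ} (h : l <+: seg i n) :
    seg i l.length = l := by
  have hl : l.length ≤ n := by simpa using h.length_le
  obtain ⟨m, rfl⟩ := Nat.exists_eq_add_of_le hl
  rw [seg_add] at h
  exact (List.prefix_of_prefix_length_le (List.prefix_append _ _) h (by simp)).eq_of_length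
    (by simp)

/-! ### The decomposition of `F_∞` into images of letters -/

lemma length_letterImage_true (k : ℕ) : (letterImage k true).length = Nat.fib (k + 1) := by
  cases k <;> simp [letterImage]

lemma length_letterImage_false (k : ℕ) : (letterImage k false).length = Nat.fib (k + 2) := by
  cases k <;> simp [letterImage]

lemma letterImage_false (k : ℕ) : letterImage k false = Fw k := by
  cases k <;> rfl

lemma Fw_succ (k : ℕ) : Fw (k + 1) = Fw k ++ letterImage k true := by
  cases k <;> rfl

lemma flatMap_letterImage_Fw (k m : ℕ) : (Fw m).flatMap (letterImage k) = Fw (k + m) := by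
  induction m using Fw.induct with
  | case1 => simp [Fw, letterImage_false]
  | case2 => simp [Fw, letterImage_false, Fw_succ]
  | case3 m h1 h2 =>
    rw [Fw, List.flatMap_append, h1, h2]
    exact (Fw.eq_3 (k + m)).symm

lemma seg_zero_imagePos (k j : ℕ) :
    seg 0 (imagePos k j) = (seg 0 j).flatMap (letterImage k) := by
  have hlen : ((seg 0 j).flatMap (letterImage k)).length = imagePos k j := by
    induction j with
    | zero => rfl
    | succ j ih =>
      rw [seg_add, List.flatMap_append, List.length_append, ih, imagePos]
      simp [seg_one]
  have hj : j ≤ (Fw j).length := by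
    have := Nat.le_fib_add_one (j + 2)
    rw [length_Fw]; omega
  have hpre : seg 0 j <+: Fw j := by
    rw [← seg_zero_length_Fw j]
    obtain ⟨m, hm⟩ := Nat.exists_eq_add_of_le hj
    rw [hm, seg_add]
    exact List.prefix_append _ _
  have hpre' : (seg 0 j).flatMap (letterImage k) <+: Fw (k + j) := by
    obtain ⟨r, hr⟩ := hpre
    rw [← flatMap_letterImage_Fw, ← hr, List.flatMap_append]
    exact List.prefix_append _ _
  rw [← seg_zero_length_Fw] at hpre'
  rw [← hlen, eq_seg_of_prefix_seg hpre']

lemma seg_imagePos (k j : ℕ) :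
    seg (imagePos k j) (letterImage k (fw j)).length = letterImage k (fw j) := by
  have h := seg_zero_imagePos k (j + 1)
  rw [imagePos, seg_add, seg_add, List.flatMap_append, seg_zero_imagePos] at h
  simpa [seg_one] using h

lemma seg_imagePos_of_false {k j : ℕ} (h : fw j = false) :
    seg (imagePos k j) (Nat.fib (k + 2)) = Fw k := by
  have := seg_imagePos k j
  rwa [h, length_letterImage_false, letterImage_false] at this

lemma seg_imagePos_of_true {k j : ℕ} (h : fw j = true) :
    seg (imagePos k j) (Nat.fib (k + 1)) = letterImage k true := by
  have := seg_imagePos k j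
  rwa [h, length_letterImage_true] at this

lemma imagePos_succ_of_false {k j : ℕ} (h : fw j = false) :
    imagePos k (j + 1) = imagePos k j + Nat.fib (k + 2) := by
  rw [imagePos, h, length_letterImage_false]

lemma imagePos_succ_of_true {k j : ℕ} (h : fw j = true) :
    imagePos k (j + 1) = imagePos k j + Nat.fib (k + 1) := by
  rw [imagePos, h, length_letterImage_true]

/-! ### Short forbidden factors -/

lemma fw_imagePos_one (j : ℕ) : fw (imagePos 1 j) = false := by
  cases h : fw j with
  | false =>
    have := seg_imagePos_of_false (k := 1) h
    simpa [Fw, seg, List.range_succ, Nat.fib] using (List.cons.inj this).1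
  | true =>
    have := seg_imagePos_of_true (k := 1) h
    simpa [letterImage, Fw, seg] using this

lemma fw_imagePos_one_add_one {j : ℕ} (h : fw j = false) : fw (imagePos 1 j + 1) = true := by
  have h2 := seg_imagePos_of_false (k := 1) h
  change seg _ (1 + 1) = [false, true] at h2
  rw [seg_add, seg_one, seg_one] at h2
  exact (List.cons.inj (List.cons.inj h2).2).1

lemma exists_imagePos_one (i : ℕ) :
    (∃ j, imagePos 1 j = i) ∨ ∃ j, fw j = false ∧ imagePos 1 j + 1 = i := by
  induction i with
  | zero => exact Or.inl ⟨0, rfl⟩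
  | succ i ih =>
    rcases ih with ⟨j, rfl⟩ | ⟨j, h, rfl⟩
    · cases h : fw j with
      | false => exact Or.inr ⟨j, h, rfl⟩
      | true => exact Or.inl ⟨j + 1, imagePos_succ_of_true h⟩
    · exact Or.inl ⟨j + 1, imagePos_succ_of_false h⟩

lemma exists_imagePos_one_of_false {i : ℕ} (h : fw i = false) : ∃ j, imagePos 1 j = i := by
  rcases exists_imagePos_one i with h' | ⟨j, hj, rfl⟩
  · exact h'
  · simp [fw_imagePos_one_add_one hj] at h

lemma fw_eq_of_imagePos_one {j : ℕ} : fw j = !fw (imagePos 1 j + 1) := by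
  cases h : fw j with
  | false => simp [fw_imagePos_one_add_one h]
  | true =>
    have h2 := fw_imagePos_one (j + 1)
    rw [imagePos_succ_of_true h] at h2
    change fw (imagePos 1 j + 1) = false at h2
    simp [h2]

/-- `bb` is not a factor of `F_∞`. -/
lemma fw_succ_of_true {i : ℕ} (h : fw i = true) : fw (i + 1) = false := by
  rcases exists_imagePos_one i with ⟨j, rfl⟩ | ⟨j, hj, rfl⟩
  · simp [fw_imagePos_one] at h
  · have := fw_imagePos_one (j + 1)
    rwa [imagePos_succ_of_false hj] at this

/-- `aaa` is not a factor of `F_∞`. -/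
lemma fw_add_two_of_false {i : ℕ} (h : fw i = false) (h' : fw (i + 1) = false) :
    fw (i + 2) = true := by
  by_contra hc
  obtain ⟨j, rfl⟩ := exists_imagePos_one_of_false h
  have hj : fw j = true := by rw [fw_eq_of_imagePos_one, h']; rfl
  have hp : imagePos 1 (j + 1) = imagePos 1 j + 1 := imagePos_succ_of_true hj
  have hj' : fw (j + 1) = true := by
    rw [fw_eq_of_imagePos_one, hp, Bool.eq_false_of_not_eq_true hc]; rfl
  simp [fw_succ_of_true hj] at hj'

/-- `babab` is not a factor of `F_∞`. -/
lemma fw_add_four_of_bab {i : ℕ} (h0 : fw i = true) (h2 : fw (i + 2) = true) :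
    fw (i + 4) = false := by
  by_contra hc
  rw [Bool.not_eq_false] at hc
  rcases exists_imagePos_one i with ⟨j, rfl⟩ | ⟨j, hj, rfl⟩
  · simp [fw_imagePos_one] at h0
  · have hp : imagePos 1 (j + 1) = imagePos 1 j + 2 := imagePos_succ_of_false hj
    have hj1 : fw (j + 1) = false := by
      rw [fw_eq_of_imagePos_one, hp, h2]; rfl
    have hp' : imagePos 1 (j + 2) = imagePos 1 j + 4 := by
      rw [imagePos_succ_of_false hj1, hp]; rfl
    have hj2 : fw (j + 2) = false := by
      rw [fw_eq_of_imagePos_one, hp', hc]; rfl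
    simp [fw_add_two_of_false hj hj1] at hj2

/-! ### Near-commutation of consecutive Fibonacci words -/

lemma exists_near_commute (k : ℕ) : ∃ (u : List Bool) (x : Bool),
    Fw k ++ letterImage k true = u ++ [x, !x] ∧ letterImage k true ++ Fw k = u ++ [!x, x] := by
  induction k with
  | zero => exact ⟨[], false, rfl, rfl⟩
  | succ k ih =>
    obtain ⟨u, x, h1, h2⟩ := ih
    refine ⟨Fw k ++ u, !x, ?_, ?_⟩
    · change Fw (k + 1) ++ Fw k = _
      rw [Fw_succ, List.append_assoc, h2]; simp
    · change Fw k ++ Fw (k + 1) = _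
      rw [Fw_succ, h1]; simp

lemma near_commute {k i : ℕ} (h : seg i (Nat.fib (k + 2) + Nat.fib (k + 1)) =
      Fw k ++ letterImage k true)
    (h' : seg (i + Nat.fib (k + 2)) (Nat.fib (k + 1) + Nat.fib (k + 2)) =
      letterImage k true ++ Fw k) :
    (∀ t, t + 2 < Nat.fib (k + 2) + Nat.fib (k + 1) → fw (i + t) = fw (i + Nat.fib (k + 2) + t)) ∧
    fw (i + Nat.fib (k + 2) + Nat.fib (k + 1) - 1) = !(Fw k).getLastD false := by
  obtain ⟨u, x, h1, h2⟩ := exists_near_commute k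
  have hlen : Nat.fib (k + 2) + Nat.fib (k + 1) = u.length + 2 := by
    simpa [length_letterImage_true] using congrArg List.length h1
  have hlast : (Fw k).getLastD false = x := by
    have hne : Fw k ≠ [] := by
      rw [← List.length_pos_iff_ne_nil, length_Fw]; exact Nat.fib_pos.2 (by omega)
    have := congrArg (fun l => l.getLastD false) h2
    simpa [List.getLastD_eq_getLast?, List.getLast?_append,
      List.getLast?_eq_some_getLast hne] using this
  rw [Nat.add_comm (Nat.fib (k + 1)), hlen, h2, seg_add] at h'
  rw [hlen, h1, seg_add] at h
  obtain ⟨h3, h4⟩ := List.append_inj h (by simp)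
  obtain ⟨h5, -⟩ := List.append_inj h' (by simp)
  refine ⟨fun t ht => seg_eq_seg_iff.1 (h3.trans h5.symm) t (by omega), ?_⟩
  have h6 : i + Nat.fib (k + 2) + Nat.fib (k + 1) - 1 = i + u.length + 1 := by omega
  change [fw (i + u.length + 0), fw (i + u.length + 1)] = _ at h4
  rw [h6, hlast]
  simpa using (List.cons.inj h4).2

/-! ### Blocks -/

lemma exists_isBlock_of_start {k j : ℕ} (hj : j = 0 ∨ ∃ i, j = i + 1 ∧ fw i = true) :
    ∃ d, IsBlock k (imagePos k j) d := by
  have h0 : fw j = false := by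
    rcases hj with rfl | ⟨i, rfl, hi⟩
    · rfl
    · exact fw_succ_of_true hi
  cases h1 : fw (j + 1) with
  | true => exact ⟨_, j, hj, rfl, Or.inl ⟨h0, h1, fw_succ_of_true h1, rfl⟩⟩
  | false =>
    have h2 := fw_add_two_of_false h0 h1
    exact ⟨_, j, hj, rfl, Or.inr ⟨h0, h1, h2, fw_succ_of_true h2, rfl⟩⟩

lemma exists_isBlock_zero (k : ℕ) : ∃ d, IsBlock k 0 d :=
  exists_isBlock_of_start (j := 0) (Or.inl rfl)

namespace IsBlock

variable {k e d : ℕ}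

lemma length_eq (h : IsBlock k e d) : d = Nat.fib (k + 2) + Nat.fib (k + 1) ∨
    d = 2 * Nat.fib (k + 2) + Nat.fib (k + 1) := by
  obtain ⟨j, -, -, ⟨-, -, -, h⟩ | ⟨-, -, -, -, h⟩⟩ := h <;> simp [h]

lemma seg_eq (h : IsBlock k e d) : seg e (Nat.fib (k + 2)) = Fw k := by
  obtain ⟨j, -, rfl, ⟨h, -⟩ | ⟨h, -⟩⟩ := h <;> exact seg_imagePos_of_false h

/-- Every block is followed by a block, and two consecutive blocks are not both short. -/
lemma next (h : IsBlock k e d) : ∃ d', IsBlock k (e + d) d' ∧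
    (d = Nat.fib (k + 2) + Nat.fib (k + 1) → d' = 2 * Nat.fib (k + 2) + Nat.fib (k + 1)) := by
  have hpos : 0 < Nat.fib (k + 2) := Nat.fib_pos.2 (by omega)
  obtain ⟨j, hj, rfl, ⟨h0, h1, h2, rfl⟩ | ⟨h0, h1, h2, h3, rfl⟩⟩ := h
  · have hp : imagePos k (j + 2) = imagePos k j + (Nat.fib (k + 2) + Nat.fib (k + 1)) := by
      rw [imagePos_succ_of_true h1, imagePos_succ_of_false h0, Nat.add_assoc]
    have h3 : fw (j + 3) = false := by
      rcases hj with rfl | ⟨i, rfl, hi⟩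
      · rfl
      · exact fw_add_four_of_bab hi h1
    have h4 := fw_add_two_of_false h2 h3
    exact ⟨_, ⟨j + 2, Or.inr ⟨j + 1, rfl, h1⟩, hp.symm,
      Or.inr ⟨h2, h3, h4, fw_succ_of_true h4, rfl⟩⟩, fun _ => rfl⟩
  · have hp : imagePos k (j + 3) = imagePos k j + (2 * Nat.fib (k + 2) + Nat.fib (k + 1)) := by
      rw [imagePos_succ_of_true h2, imagePos_succ_of_false h1, imagePos_succ_of_false h0]
      omega
    obtain ⟨d', hd'⟩ := exists_isBlock_of_start (k := k) (j := j + 3) (Or.inr ⟨j + 2, rfl, h2⟩)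
    exact ⟨d', hp ▸ hd', by omega⟩

lemma fw_add_fib_and_fw_last (h : IsBlock k e d) :
    (∀ t, t + 2 < d → fw (e + t) = fw (e + Nat.fib (k + 2) + t)) ∧
    fw (e + d - 1) = !(Fw k).getLastD false := by
  have key : ∀ j, fw j = false → fw (j + 1) = true → fw (j + 2) = false →
      (∀ t, t + 2 < Nat.fib (k + 2) + Nat.fib (k + 1) →
        fw (imagePos k j + t) = fw (imagePos k j + Nat.fib (k + 2) + t)) ∧
      fw (imagePos k j + Nat.fib (k + 2) + Nat.fib (k + 1) - 1) = !(Fw k).getLastD false := by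
    intro j h0 h1 h2
    have p1 := imagePos_succ_of_false (k := k) h0
    have p2 := imagePos_succ_of_true (k := k) h1
    have s0 := seg_imagePos_of_false (k := k) h0
    have s1 := seg_imagePos_of_true (k := k) h1
    have s2 := seg_imagePos_of_false (k := k) h2
    rw [show j + 2 = j + 1 + 1 from rfl, p2] at s2
    rw [p1] at s1 s2
    exact near_commute (by rw [seg_add, s0, s1]) (by rw [seg_add, s1, s2])
  obtain ⟨j, -, rfl, ⟨h0, h1, h2, rfl⟩ | ⟨h0, h1, h2, h3, rfl⟩⟩ := h
  · rw [← Nat.add_assoc]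
    exact key j h0 h1 h2
  · have p1 := imagePos_succ_of_false (k := k) h0
    obtain ⟨k1, k2⟩ := key (j + 1) h1 h2 h3
    rw [p1] at k1 k2
    refine ⟨fun t ht => ?_, ?_⟩
    · rcases Nat.lt_or_ge t (Nat.fib (k + 2)) with h | h
      · refine seg_eq_seg_iff.1 ?_ t h
        rw [← p1, seg_imagePos_of_false h0, seg_imagePos_of_false h1]
      · obtain ⟨r, rfl⟩ := Nat.exists_eq_add_of_le h
        have := k1 r (by omega)
        rw [← Nat.add_assoc, this, ← Nat.add_assoc]
    · rw [← k2]; congr 1; omega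

lemma fw_eq_mod (h : IsBlock k e d) {t : ℕ} (ht : t + 2 < d + Nat.fib (k + 2)) :
    fw (e + t) = fw (t % Nat.fib (k + 2)) := by
  have hpos : 0 < Nat.fib (k + 2) := Nat.fib_pos.2 (by omega)
  induction t using Nat.strong_induction_on with
  | _ t ih =>
    rcases Nat.lt_or_ge t (Nat.fib (k + 2)) with hlt | hge
    · rw [Nat.mod_eq_of_lt hlt]
      have hz : seg 0 (Nat.fib (k + 2)) = Fw k := by
        rw [← length_Fw, seg_zero_length_Fw]
      have := seg_eq_seg_iff.1 (h.seg_eq.trans hz.symm) t hlt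
      rwa [Nat.zero_add] at this
    · obtain ⟨r, rfl⟩ := Nat.exists_eq_add_of_le hge
      rw [← Nat.add_assoc, ← h.fw_add_fib_and_fw_last.1 r (by omega), ih r (by omega) (by omega),
        Nat.add_mod_left]

end IsBlock

lemma length_sw_succ (k : ℕ) : (sw (k + 1)).length = Nat.fib (k + 2) := by
  have : 0 < Nat.fib (k + 2) := Nat.fib_pos.2 (by omega)
  simp only [sw, List.length_cons, List.length_dropLast, length_Fw]
  omega

lemma exists_isBlock_around (k i : ℕ) : ∃ e d, IsBlock k e d ∧ e ≤ i ∧ i < e + d := by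
  have hpos : 0 < Nat.fib (k + 2) := Nat.fib_pos.2 (by omega)
  induction i with
  | zero =>
    obtain ⟨d, hd⟩ := exists_isBlock_zero k
    have := hd.length_eq
    exact ⟨0, d, hd, le_rfl, by omega⟩
  | succ i ih =>
    obtain ⟨e, d, hd, h1, h2⟩ := ih
    rcases Nat.lt_or_ge (i + 1) (e + d) with h | h
    · exact ⟨e, d, hd, by omega, h⟩
    · obtain ⟨d', hd', -⟩ := hd.next
      have := hd'.length_eq
      exact ⟨e + d, d', hd', by omega, by omega⟩

namespace IsBlock

variable {k e d : ℕ}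

/-- The singular word `s_k` occurs at the last letter of each block. -/
lemma occursAt_sw (h : IsBlock k e d) : OccursAt (sw (k + 1)) (e + d - 1) := by
  have hpos : 0 < Nat.fib (k + 2) := Nat.fib_pos.2 (by omega)
  have hlen := h.length_eq
  obtain ⟨d', hd', -⟩ := h.next
  have hs := hd'.seg_eq
  obtain ⟨m, hm⟩ : ∃ m, Nat.fib (k + 2) = m + 1 := ⟨_, (Nat.succ_pred_eq_of_pos hpos).symm⟩
  rw [OccursAt, length_sw_succ, sw, hm, seg_succ, h.fw_add_fib_and_fw_last.2,
    show e + d - 1 + 1 = e + d by omega, ← hs, hm, seg_add, seg_one, List.dropLast_concat]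

/-- Inside a block, `s_k` occurs only at the last letter. -/
lemma not_occursAt_sw (h : IsBlock k e d) {x : ℕ} (h1 : e ≤ x) (h2 : x + 1 < e + d) :
    ¬ OccursAt (sw (k + 1)) x := by
  intro hx
  have hcount : ∀ s, s + 1 < d →
      (seg (e + s) (Nat.fib (k + 2))).count true = (Fw k).count true := by
    intro s
    induction s with
    | zero => exact fun _ => congrArg _ h.seg_eq
    | succ s ih =>
      intro hs
      have hper := h.fw_add_fib_and_fw_last.1 s (by omega)
      have hshift := (seg_succ (e + s) (Nat.fib (k + 2))).symm.trans (seg_add (e + s) _ 1)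
      have := congrArg (List.count true) hshift
      rw [List.count_cons, List.count_append, seg_one, List.count_singleton, hper,
        Nat.add_right_comm e _ s] at this
      rw [← ih (by omega), ← Nat.add_assoc]
      exact Nat.add_right_cancel this
  obtain ⟨s, rfl⟩ := Nat.exists_eq_add_of_le h1
  replace hcount := hcount s (by omega)
  rw [OccursAt, length_sw_succ] at hx
  rw [hx, sw] at hcount
  have hne : Fw k ≠ [] := by
    rw [← List.length_pos_iff_ne_nil, length_Fw]; exact Nat.fib_pos.2 (by omega)
  have hd := congrArg (List.count true) (List.dropLast_append_getLast hne)
  have hl : (Fw k).getLastD false = (Fw k).getLast hne := by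
    simp [List.getLastD_eq_getLast?, List.getLast?_eq_some_getLast hne]
  rw [hl] at hcount
  rw [List.count_append] at hd
  cases hb : (Fw k).getLast hne <;> simp [hb] at hcount hd <;> omega

end IsBlock

lemma occursAt_sw_add_le {k x y : ℕ} (hx : OccursAt (sw (k + 1)) x)
    (hy : OccursAt (sw (k + 1)) y) (hxy : x < y) :
    x + (Nat.fib (k + 2) + Nat.fib (k + 1)) ≤ y := by
  obtain ⟨e, d, hb, h1, h2⟩ := exists_isBlock_around k x
  have hxe : x + 1 = e + d := by
    by_contra hne
    exact hb.not_occursAt_sw h1 (by omega) hx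
  obtain ⟨d', hb', -⟩ := hb.next
  have hlen := hb'.length_eq
  by_contra hlt
  exact hb'.not_occursAt_sw (x := y) (by omega) (by omega) hy

/-! ### Occurrences of factors -/

lemma occursAt_add_of_append {u v w : List Bool} {i : ℕ} (h : OccursAt (u ++ v ++ w) i) :
    OccursAt v (i + u.length) := by
  rw [OccursAt, List.length_append, List.length_append, seg_add, seg_add] at h
  exact (List.append_inj (List.append_inj h (by simp)).1 (by simp)).2

lemma infix_of_occursAt {v w : List Bool} {i m : ℕ} (hw : OccursAt w i) (hv : OccursAt v (i + m))
    (h : m + v.length ≤ w.length) : v <:+: w := by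
  obtain ⟨r, hr⟩ := Nat.exists_eq_add_of_le h
  rw [OccursAt, hr, seg_add, seg_add, hv] at hw
  exact ⟨_, _, hw⟩

lemma occursAt_of_fw_eq {w : List Bool} {i j : ℕ} (h : OccursAt w i)
    (hij : ∀ t < w.length, fw (j + t) = fw (i + t)) : OccursAt w j :=
  (seg_eq_seg_iff.2 hij).trans h

/-- Every factor of `F_∞` occurs infinitely often. -/
lemma IsFactor.infinite {w : List Bool} (h : IsFactor w) : {i | OccursAt w i}.Infinite := by
  obtain ⟨i, hi⟩ := h
  set K := i + w.length with hK
  have hlen : i + w.length ≤ Nat.fib (K + 2) := by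
    have := Nat.le_fib_add_one (K + 2)
    omega
  rw [Set.infinite_iff_exists_gt]
  intro n
  obtain ⟨e, d, hb, h1, h2⟩ := exists_isBlock_around K n
  obtain ⟨d', hb', -⟩ := hb.next
  have hl := hb'.length_eq
  refine ⟨e + d + i, occursAt_of_fw_eq hi fun t ht => ?_, by omega⟩
  have hpos : 0 < Nat.fib (K + 1) := Nat.fib_pos.2 (by omega)
  rw [Nat.add_assoc, hb'.fw_eq_mod (by omega), Nat.mod_eq_of_lt (by omega)]

/-- The occurrences of a factor without `s_k` stay within the `f_k`-periodic stretch that begins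
with the block in which they start. -/
lemma IsBlock.occursAt_end_lt {k e d i : ℕ} {w : List Bool} (hb : IsBlock k e d)
    (hw : OccursAt w i) (hs : ¬ sw (k + 1) <:+: w) (h2 : i < e + d) :
    i + w.length + 1 < e + d + Nat.fib (k + 2) := by
  by_contra hlt
  refine hs (infix_of_occursAt (m := e + d - 1 - i) hw ?_ ?_)
  · rw [show i + (e + d - 1 - i) = e + d - 1 by omega]
    exact hb.occursAt_sw
  · rw [length_sw_succ]; omega

lemma IsBlock.occursAt_add_fib {k e d i j : ℕ} {w : List Bool} (hb : IsBlock k e d)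
    (hw : OccursAt w i) (hj : OccursAt w j) (hs : ¬ sw (k + 1) <:+: w)
    (h1 : e ≤ i) (hij : i + Nat.fib (k + 2) ≤ j) (h2 : j < e + d) :
    OccursAt w (i + Nat.fib (k + 2)) := by
  have hend := hb.occursAt_end_lt hj hs h2
  obtain ⟨s, rfl⟩ := Nat.exists_eq_add_of_le h1
  refine occursAt_of_fw_eq hw fun t ht => ?_
  have := hb.fw_add_fib_and_fw_last.1 (s + t) (by omega)
  rw [show e + s + Nat.fib (k + 2) + t = e + Nat.fib (k + 2) + (s + t) by omega, ← this,
    Nat.add_assoc]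

/-- A factor shorter than `f_{k+1}` without `s_k` occurs twice, at distance `f_k`, in every long
block. -/
lemma IsBlock.exists_occursAt_pair {k e i : ℕ} {w : List Bool}
    (hb : IsBlock k e (2 * Nat.fib (k + 2) + Nat.fib (k + 1)))
    (hw : OccursAt w i) (hs : ¬ sw (k + 1) <:+: w)
    (hlen : w.length < Nat.fib (k + 2) + Nat.fib (k + 1)) :
    ∃ y, e ≤ y ∧ y < e + Nat.fib (k + 2) ∧ OccursAt w y ∧ OccursAt w (y + Nat.fib (k + 2)) := by
  have hpos : 0 < Nat.fib (k + 2) := Nat.fib_pos.2 (by omega)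
  obtain ⟨e', d, hb', h1, h2⟩ := exists_isBlock_around k i
  have hend := hb'.occursAt_end_lt hw hs h2
  obtain ⟨s, rfl⟩ := Nat.exists_eq_add_of_le h1
  have hmod := Nat.mod_lt s hpos
  refine ⟨e + s % Nat.fib (k + 2), by omega, by omega, ?_, ?_⟩ <;>
  · refine occursAt_of_fw_eq hw fun t ht => ?_
    simp only [Nat.add_assoc]
    rw [hb.fw_eq_mod (by omega), hb'.fw_eq_mod (by omega)]
    simp [Nat.add_left_comm s]

/-- Among four consecutive occurrences of a factor without `s_k`, two consecutive ones are not
separated. -/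
lemma exists_not_separated {k : ℕ} {w : List Bool} (hfac : IsFactor w)
    (hs : ¬ sw (k + 1) <:+: w) (h1 : Nat.fib (k + 2) ≤ w.length)
    (h2 : w.length < Nat.fib (k + 2) + Nat.fib (k + 1)) (p : ℕ)
    (hsep : ∀ q, p ≤ q → q ≤ p + 2 → occPos w q + w.length < occPos w (q + 1)) : False := by
  have hinf := hfac.infinite
  have hocc : ∀ q, OccursAt w (occPos w q) := Nat.nth_mem_of_infinite hinf
  have hmono : StrictMono (occPos w) := Nat.nth_strictMono hinf
  have hsurj : ∀ y, OccursAt w y → ∃ q, occPos w q = y := fun y hy => by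
    obtain ⟨q, -, hq⟩ := Nat.exists_lt_card_nth_eq hy
    exact ⟨q, hq⟩
  -- an occurrence followed by one at distance `f_k` is not among the first three
  have hpair : ∀ y, OccursAt w y → OccursAt w (y + Nat.fib (k + 2)) → occPos w p ≤ y →
      occPos w (p + 3) ≤ y := by
    intro y hy hy' hpy
    obtain ⟨q, rfl⟩ := hsurj y hy
    obtain ⟨r, hr⟩ := hsurj _ hy'
    have hpos : 0 < Nat.fib (k + 2) := Nat.fib_pos.2 (by omega)
    have hqr : q < r := hmono.lt_iff_lt.1 (by omega)
    have hle : occPos w (q + 1) ≤ occPos w r := hmono.monotone hqr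
    refine hmono.monotone ?_
    by_contra hlt
    have := hsep q (hmono.le_iff_le.1 hpy) (by omega)
    omega
  have g0 := hsep p (by omega) (by omega)
  have g1 := hsep (p + 1) (by omega) (by omega)
  have g2 := hsep (p + 2) (by omega) (by omega)
  -- consecutive separated occurrences lie in different blocks
  have hblock : ∀ q, p ≤ q → q ≤ p + 2 → ∀ e d, IsBlock k e d → e ≤ occPos w q →
      e + d ≤ occPos w (q + 1) := by
    intro q hq hq' e d hb he
    by_contra hlt
    have hg := hsep q hq hq'
    have ho := hb.occursAt_add_fib (hocc q) (hocc (q + 1)) hs he (by omega) (by omega)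
    have h3 := hpair _ (hocc q) ho (hmono.monotone hq)
    have h4 := hmono.le_iff_le.1 h3
    omega
  obtain ⟨e, d, hb, he, hed⟩ := exists_isBlock_around k (occPos w p)
  have k1 := hblock p (by omega) (by omega) e d hb he
  obtain ⟨d', hb', -⟩ := hb.next
  have k2 := hblock (p + 1) (by omega) (by omega) _ _ hb' k1
  rcases hb'.length_eq with hd' | hd'
  · obtain ⟨d'', hb'', hl⟩ := hb'.next
    rw [hl hd'] at hb''
    obtain ⟨y, hy1, hy2, ho, ho'⟩ := hb''.exists_occursAt_pair (hocc p) hs h2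
    have := hpair y ho ho' (by omega)
    simp only [Nat.add_assoc, Nat.reduceAdd] at *
    omega
  · rw [hd'] at hb'
    obtain ⟨y, hy1, hy2, ho, ho'⟩ := hb'.exists_occursAt_pair (hocc p) hs h2
    have := hpair y ho ho' (by omega)
    simp only [Nat.add_assoc, Nat.reduceAdd] at *
    omega

/-- A singular word of length less than `f_{k+1}` has length at most `f_k`. -/
lemma IsSingular.length_le {k : ℕ} {v : List Bool} (hv : IsSingular v)
    (h : v.length < Nat.fib (k + 3)) : v.length ≤ Nat.fib (k + 2) := by
  obtain ⟨_ | n, rfl⟩ := hv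
  · exact Nat.fib_pos.2 (by omega)
  · rw [length_sw_succ] at h ⊢
    refine Nat.fib_mono ?_
    by_contra hlt
    have := Nat.fib_mono (show k + 3 ≤ n + 2 by omega)
    omega

/-- for a factor `ω ∉ {ε,ab,ba,aba}` of `F_∞` with `f_k ≤ |ω| < f_{k+1}`,
the following are equivalent: (i) some three consecutive gaps of `ω` are all nonempty
words (consecutive occurrences separated); (ii) every pair of consecutive occurrences
of `ω` is separated by a nonempty word; (iii) `sk(ω) = s_k` (i.e. `ω ∈ T1.1 ⊔ T2.1`). -/
theorem stmt19 (k : ℕ) (ω : List Bool) (hfac : IsFactor ω) (hne : ω ∉ excl)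
    (h1 : Nat.fib (k+2) ≤ ω.length) (h2 : ω.length < Nat.fib (k+3)) :
    ((∃ p : ℕ, ∀ q : ℕ, p ≤ q → q ≤ p + 2 → occPos ω q + ω.length < occPos ω (q+1)) ↔
      (∀ p : ℕ, occPos ω p + ω.length < occPos ω (p+1))) ∧
    ((∀ p : ℕ, occPos ω p + ω.length < occPos ω (p+1)) ↔ IsKernelOf (sw (k+1)) ω) := by
  have hlt : ω.length < Nat.fib (k + 2) + Nat.fib (k + 1) := by
    rw [Nat.add_comm]
    exact h2.trans_eq Nat.fib_add_two
  have himp : (∃ p : ℕ, ∀ q : ℕ, p ≤ q → q ≤ p + 2 →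
      occPos ω q + ω.length < occPos ω (q+1)) → sw (k + 1) <:+: ω := by
    rintro ⟨p, hp⟩
    by_contra hs
    exact exists_not_separated hfac hs h1 hlt p hp
  have hsep : sw (k + 1) <:+: ω → ∀ p : ℕ, occPos ω p + ω.length < occPos ω (p+1) := by
    rintro ⟨u, v, huv⟩ p
    have hocc : ∀ q, OccursAt (sw (k + 1)) (occPos ω q + u.length) := fun q => by
      have hq : OccursAt ω (occPos ω q) := Nat.nth_mem_of_infinite hfac.infinite q
      generalize occPos ω q = i at hq ⊢
      exact occursAt_add_of_append (huv.symm ▸ hq)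
    have hmono : occPos ω p < occPos ω (p + 1) :=
      Nat.nth_strictMono hfac.infinite p.lt_succ_self
    have := occursAt_sw_add_le (hocc p) (hocc (p + 1)) (by omega)
    omega
  refine ⟨⟨fun h => hsep (himp h), fun h => ⟨0, fun q _ _ => h q⟩⟩,
    ⟨fun h => ⟨⟨k + 1, rfl⟩, himp ⟨0, fun q _ _ => h q⟩, fun v hv hvw => ?_⟩,
      fun h => hsep h.2.1⟩⟩
  rw [length_sw_succ]
  exact hv.length_le (hvw.length_le.trans_lt h2)
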